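/- arXiv:1107.5191 — 5 statements merged into one kernel-verified Lean document; each statement's English description precedes it below -/
import Mathlib

section
/- For every integer k ≥ 5.5·10^5, one has π(k+1) + 100 < φ(k). -/
open scoped BigOperators

/-- Number of primes not exceeding the real number `x` (so `primePi x = 0` for `x ≤ 1`). -/
noncomputable def primePi (x : ℝ) : ℕ :=
  ((Finset.range (⌊x⌋₊ + 1)).filter Nat.Prime).card

/-- The `n`-th prime, with `nthPrime 1 = 2`, `nthPrime 2 = 3`, etc. -/
noncomputable def nthPrime (n : ℕ) : ℕ := Nat.nth Nat.Prime (n - 1)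

theorem Nat.nth_prime_card_le_of_forall_lt {s : Finset ℕ} {a : ℕ} (hs : ∀ p ∈ s, p.Prime)
    (ha : a.Prime) (hlt : ∀ p ∈ s, p < a) : Nat.nth Nat.Prime s.card ≤ a := by
  have hcard : s.card ≤ Nat.count Nat.Prime a := by
    rw [Nat.count_eq_card_filter_range]
    exact Finset.card_le_card fun p hp => by simp [hs p hp, hlt p hp]
  calc Nat.nth Nat.Prime s.card ≤ Nat.nth Nat.Prime (Nat.count Nat.Prime a) :=
        Nat.nth_monotone Nat.infinite_setOfPred_prime hcard
    _ = a := Nat.nth_count ha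

/-- Among sets of `r` primes, the first `r` primes minimise the product of a nonnegative
monotone function. -/
theorem Finset.prod_nth_prime_le_prod {f : ℕ → ℝ} (hf : Monotone f) (hf0 : ∀ n, 0 ≤ f n)
    (s : Finset ℕ) (hs : ∀ p ∈ s, p.Prime) :
    ∏ i ∈ Finset.range s.card, f (Nat.nth Nat.Prime i) ≤ ∏ p ∈ s, f p := by
  induction s using Finset.induction_on_max with
  | empty => simp
  | insert a s hlt ih =>
    have ha : a ∉ s := fun h => lt_irrefl _ (hlt a h)
    have hs' : ∀ p ∈ s, p.Prime := fun p hp => hs p (Finset.mem_insert_of_mem hp)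
    rw [Finset.card_insert_of_notMem ha, Finset.prod_range_succ, Finset.prod_insert ha, mul_comm]
    gcongr
    · exact Finset.prod_nonneg fun _ _ => hf0 _
    · exact hf0 _
    · exact hf (Nat.nth_prime_card_le_of_forall_lt hs' (hs a (Finset.mem_insert_self a s)) hlt)
    · exact ih hs'

theorem Nat.nth_prime_add_seven_ge (i : ℕ) : 19 + i ≤ Nat.nth Nat.Prime (i + 7) := by
  induction i with
  | zero =>
    have h : Nat.nth Nat.Prime (Nat.count Nat.Prime 19) = 19 := Nat.nth_count (by norm_num)
    rw [show Nat.count Nat.Prime 19 = 7 by decide] at h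
    simp [h]
  | succ i ih =>
    have : Nat.nth Nat.Prime (i + 7) < Nat.nth Nat.Prime (i + 1 + 7) :=
      Nat.nth_strictMono Nat.infinite_setOfPred_prime (by omega)
    omega

theorem prod_range_seven_nth_prime (f : ℕ → ℝ) :
    ∏ i ∈ Finset.range 7, f (Nat.nth Nat.Prime i) =
      f 2 * f 3 * f 5 * f 7 * f 11 * f 13 * f 17 := by
  have h (p : ℕ) (hp : p.Prime) (i : ℕ) (hi : Nat.count Nat.Prime p = i) :
      Nat.nth Nat.Prime i = p := hi ▸ Nat.nth_count hp
  simp only [Finset.prod_range_succ, Finset.prod_range_zero, one_mul,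
    h 2 (by norm_num) 0 (by decide), h 3 (by norm_num) 1 (by decide),
    h 5 (by norm_num) 2 (by decide), h 7 (by norm_num) 3 (by decide),
    h 11 (by norm_num) 4 (by decide), h 13 (by norm_num) 5 (by decide),
    h 17 (by norm_num) 6 (by decide)]

theorem one_sub_inv_natCast_monotone : Monotone fun n : ℕ => if n = 0 then 0 else 1 - (n : ℝ)⁻¹ := by
  intro a b hab
  rcases Nat.eq_zero_or_pos a with rfl | ha
  · rcases Nat.eq_zero_or_pos b with rfl | hb
    · simp
    · have : (1 : ℝ) ≤ b := by exact_mod_cast hb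
      simpa [hb.ne'] using inv_le_one_of_one_le₀ this
  · have hb : 0 < b := ha.trans_le hab
    have ha' : (0 : ℝ) < a := by exact_mod_cast ha
    simp only [ha.ne', hb.ne', if_false]
    gcongr

theorem one_sub_inv_nth_prime_prod_ge (r : ℕ) :
    92160 / 510510 * (18 / (18 + ((r - 7 : ℕ) : ℝ))) ≤
      ∏ i ∈ Finset.range r, (1 - ((Nat.nth Nat.Prime i : ℕ) : ℝ)⁻¹) := by
  have hfac (i : ℕ) : 0 ≤ 1 - ((Nat.nth Nat.Prime i : ℕ) : ℝ)⁻¹ ∧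
      1 - ((Nat.nth Nat.Prime i : ℕ) : ℝ)⁻¹ ≤ 1 := by
    have : (1 : ℝ) ≤ Nat.nth Nat.Prime i := by
      exact_mod_cast (Nat.prime_nth_prime i).one_lt.le
    exact ⟨sub_nonneg.2 (inv_le_one_of_one_le₀ this), by simp⟩
  have h7 := prod_range_seven_nth_prime fun n => 1 - (n : ℝ)⁻¹
  norm_num at h7
  rcases le_total r 7 with hr | hr
  · rw [Nat.sub_eq_zero_of_le hr]
    calc _ ≤ ∏ i ∈ Finset.range 7, (1 - ((Nat.nth Nat.Prime i : ℕ) : ℝ)⁻¹) := by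
          rw [h7]; norm_num
      _ ≤ _ := Finset.prod_le_prod_of_subset_of_le_one (by simpa using hr)
          (fun i _ => (hfac i).1) (fun i _ _ => (hfac i).2)
  · obtain ⟨s, rfl⟩ := Nat.exists_eq_add_of_le' hr
    rw [Nat.add_sub_cancel]
    clear hr
    induction s with
    | zero => simp only [zero_add]; rw [h7]; norm_num
    | succ s ih =>
      rw [show s + 1 + 7 = (s + 7) + 1 by ring, Finset.prod_range_succ]
      have hp : (19 + s : ℝ) ≤ Nat.nth Nat.Prime (s + 7) := by
        exact_mod_cast Nat.nth_prime_add_seven_ge s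
      have hinv : 1 - (19 + s : ℝ)⁻¹ ≤ 1 - ((Nat.nth Nat.Prime (s + 7) : ℕ) : ℝ)⁻¹ := by
        gcongr
      calc _ = 92160 / 510510 * (18 / (18 + (s : ℝ))) * (1 - (19 + s : ℝ)⁻¹) := by
            push_cast
            have h1 : (18 + s : ℝ) ≠ 0 := by positivity
            have h2 : (19 + s : ℝ) ≠ 0 := by positivity
            have h3 : (18 + (s + 1) : ℝ) ≠ 0 := by positivity
            field_simp
            ring
        _ ≤ _ := mul_le_mul ih hinv
            (sub_nonneg.2 (inv_le_one_of_one_le₀ (by linarith [s.cast_nonneg (α := ℝ)])))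
            (Finset.prod_nonneg fun i _ => (hfac i).1)

theorem nth_prime_prod_ge (s : ℕ) :
    (510510 * 19 ^ s : ℝ) ≤ ∏ i ∈ Finset.range (s + 7), ((Nat.nth Nat.Prime i : ℕ) : ℝ) := by
  induction s with
  | zero =>
    have h7 := prod_range_seven_nth_prime fun n => (n : ℝ)
    norm_num at h7
    rw [zero_add, h7]; norm_num
  | succ s ih =>
    have hp : (19 : ℝ) ≤ Nat.nth Nat.Prime (s + 7) := by
      exact_mod_cast (Nat.le_add_right 19 s).trans (Nat.nth_prime_add_seven_ge s)
    rw [show s + 1 + 7 = (s + 7) + 1 by ring, Finset.prod_range_succ, pow_succ, ← mul_assoc]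
    gcongr

theorem mul_nineteen_pow_le {k : ℕ} (hk : 510510 ≤ k) :
    (510510 * 19 ^ (k.primeFactors.card - 7) : ℝ) ≤ k := by
  rcases le_total k.primeFactors.card 7 with h | h
  · rw [Nat.sub_eq_zero_of_le h]
    simpa using (show (510510 : ℝ) ≤ k by exact_mod_cast hk)
  · have h1 := nth_prime_prod_ge (k.primeFactors.card - 7)
    rw [Nat.sub_add_cancel h] at h1
    have h2 := Finset.prod_nth_prime_le_prod (f := fun n => (n : ℝ)) Nat.mono_cast
      (fun n => n.cast_nonneg) k.primeFactors fun p hp => Nat.prime_of_mem_primeFactors hp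
    have h3 : (∏ p ∈ k.primeFactors, (p : ℝ)) ≤ k := by
      rw [← Nat.cast_prod]
      exact_mod_cast Nat.le_of_dvd (by omega) (Nat.prod_primeFactors_dvd k)
    exact h1.trans (h2.trans h3)

theorem totient_ge (k : ℕ) :
    k * (92160 / 510510 * (18 / (18 + ((k.primeFactors.card - 7 : ℕ) : ℝ)))) ≤
      (k.totient : ℝ) := by
  have htot : (k.totient : ℝ) = k * ∏ p ∈ k.primeFactors, (1 - (p : ℝ)⁻¹) := by
    have := congrArg (fun q : ℚ => (q : ℝ)) (Nat.totient_eq_mul_prod_factors k)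
    push_cast at this
    exact this
  have h := Finset.prod_nth_prime_le_prod one_sub_inv_natCast_monotone
    (fun n => by simpa using one_sub_inv_natCast_monotone n.zero_le) k.primeFactors
    fun p hp => Nat.prime_of_mem_primeFactors hp
  rw [Finset.prod_congr rfl fun i _ => if_neg (Nat.prime_nth_prime i).ne_zero,
    Finset.prod_congr rfl fun p hp => if_neg (Nat.prime_of_mem_primeFactors hp).ne_zero] at h
  rw [htot]
  gcongr
  exact (one_sub_inv_nth_prime_prod_ge _).trans h

theorem card_primes_le (n : ℕ) {y : ℝ} (hy : 1 < y) :
    (((Finset.range (n + 1)).filter Nat.Prime).card : ℝ) ≤ y + Real.log 4 * n / Real.log y := by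
  have hlog : 0 < Real.log y := Real.log_pos hy
  set P := (Finset.range (n + 1)).filter Nat.Prime
  rw [← Finset.card_filter_add_card_filter_not (s := P) (fun p : ℕ => (p : ℝ) ≤ y)]
  push_cast
  gcongr
  · have : (P.filter fun p : ℕ => (p : ℝ) ≤ y).card ≤ (Finset.Ioc 0 ⌊y⌋₊).card := by
      refine Finset.card_le_card fun p hp => ?_
      simp only [P, Finset.mem_filter] at hp
      exact Finset.mem_Ioc.2 ⟨hp.1.2.pos, Nat.le_floor hp.2⟩
    rw [Nat.card_Ioc, Nat.sub_zero] at this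
    exact (Nat.cast_le.2 this).trans (Nat.floor_le (by linarith))
  · rw [le_div_iff₀ hlog]
    calc _ = ∑ p ∈ P.filter fun p : ℕ => ¬ (p : ℝ) ≤ y, Real.log y := by simp
      _ ≤ ∑ p ∈ P.filter fun p : ℕ => ¬ (p : ℝ) ≤ y, Real.log p := by
          refine Finset.sum_le_sum fun p hp => ?_
          have := (Finset.mem_filter.1 hp).2
          exact Real.log_le_log (by linarith) (by linarith)
      _ ≤ ∑ p ∈ P, Real.log p := Finset.sum_le_sum_of_subset_of_nonneg (Finset.filter_subset _ _)
          fun p _ _ => Real.log_natCast_nonneg p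
      _ = Real.log (primorial n) := by
          rw [primorial, Nat.cast_prod, Real.log_prod]
          intro p hp
          exact_mod_cast (Finset.mem_filter.1 hp).2.ne_zero
      _ ≤ Real.log (4 ^ n) := by
          apply Real.log_le_log (by exact_mod_cast primorial_pos n)
          exact_mod_cast primorial_le_four_pow n
      _ = _ := by rw [Real.log_pow, mul_comm]

theorem thirteen_add_two_mul_le_log {x : ℝ} {s : ℕ} (h : 510510 * 19 ^ s ≤ x) :
    13 + 2 * (s : ℝ) ≤ Real.log x := by
  have he := Real.exp_one_lt_d9
  have he0 := Real.exp_pos 1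
  refine (Real.le_log_iff_exp_le (lt_of_lt_of_le (by positivity) h)).2 (le_trans ?_ h)
  rw [Real.exp_add, mul_comm 2, Real.exp_nat_mul]
  gcongr
  · rw [show (13 : ℝ) = (13 : ℕ) * 1 by norm_num, Real.exp_nat_mul]
    exact (pow_le_pow_left₀ he0.le he.le 13).trans (by norm_num)
  · rw [show (2 : ℝ) = (2 : ℕ) * 1 by norm_num, Real.exp_nat_mul]
    exact (pow_le_pow_left₀ he0.le he.le 2).trans (by norm_num)

theorem log_ge_of_ge {x : ℝ} (h : 550000 ≤ x) : 13.2 ≤ Real.log x := by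
  refine (Real.le_log_iff_exp_le (by linarith)).2 (le_trans ?_ h)
  refine le_of_pow_le_pow_left₀ (n := 5) (by norm_num) (by norm_num) ?_
  rw [← Real.exp_nat_mul, show ((5 : ℕ) : ℝ) * 13.2 = (66 : ℕ) * 1 by norm_num, Real.exp_nat_mul]
  exact (pow_le_pow_left₀ (Real.exp_pos 1).le Real.exp_one_lt_d9.le 66).trans (by norm_num)

theorem mul_le_exp {t : ℝ} (ht : 4.4 ≤ t) : 81 ≤ Real.exp t ∧ t ≤ 4.4 / 81 * Real.exp t := by
  have h81 : 81 ≤ Real.exp 4.4 := by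
    refine le_of_pow_le_pow_left₀ (n := 5) (by norm_num) (Real.exp_pos _).le ?_
    rw [← Real.exp_nat_mul, show ((5 : ℕ) : ℝ) * 4.4 = (22 : ℕ) * 1 by norm_num, Real.exp_nat_mul]
    exact le_trans (by norm_num) (pow_le_pow_left₀ (by norm_num) Real.exp_one_gt_d9.le 22)
  have hexp : Real.exp t = Real.exp 4.4 * Real.exp (t - 4.4) := by
    rw [← Real.exp_add]; ring_nf
  have hlin : 81 * (t - 4.4 + 1) ≤ Real.exp t := by
    rw [hexp]
    exact mul_le_mul h81 (Real.add_one_le_exp _) (by linarith) (Real.exp_pos _).le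
  constructor <;> linarith

theorem primePi_add_100_lt_totient (k : ℕ) (hk : 550000 ≤ k) :
    primePi ((k : ℝ) + 1) + 100 < k.totient := by
  have hk' : (550000 : ℝ) ≤ k := by exact_mod_cast hk
  have hk0 : (0 : ℝ) < k := by linarith
  set s := k.primeFactors.card - 7 with hs
  set t := Real.log k / 3 with ht
  have hlog : Real.log k = 3 * t := by rw [ht]; ring
  have ht1 : 4.4 ≤ t := by linarith [log_ge_of_ge hk']
  have hts : 13 + 2 * (s : ℝ) ≤ 3 * t :=
    hlog ▸ thirteen_add_two_mul_le_log (mul_nineteen_pow_le (by omega))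
  obtain ⟨hE81, htE⟩ := mul_le_exp ht1
  set E := Real.exp t with hE
  have hkE : (k : ℝ) = E ^ 3 := by
    rw [hE, ← Real.exp_nat_mul, ← Real.exp_log hk0, hlog]; norm_num
  have hpi : (primePi ((k : ℝ) + 1) : ℝ) ≤ E ^ 2 + Real.log 4 * (k + 1) / (2 * t) := by
    have hfloor : ⌊(k : ℝ) + 1⌋₊ = k + 1 := by exact_mod_cast Nat.floor_natCast (R := ℝ) (k + 1)
    have h := card_primes_le (k + 1) (y := E ^ 2) (by nlinarith)
    rw [Real.log_pow, hE, Real.log_exp] at h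
    rw [primePi, hfloor]
    exact_mod_cast h
  have hlog4 : Real.log 4 ≤ 1.3863 := by
    rw [show (4 : ℝ) = 2 ^ 2 by norm_num, Real.log_pow]
    norm_num
    linarith [Real.log_two_lt_d9]
  have hmain : 3 * t * (primePi ((k : ℝ) + 1) + 100) ≤ 2.25 * k := by
    have h1 : 3 * t * E ^ 2 ≤ 0.163 * k := by rw [hkE]; nlinarith [sq_nonneg E]
    have h2 : 300 * t ≤ 0.0025 * k := by
      have : 81 ^ 2 * E ≤ k := by
        rw [hkE, pow_succ E 2]; gcongr
      linarith
    have h3 : 3 * t * (Real.log 4 * (k + 1) / (2 * t)) = 1.5 * (Real.log 4 * (k + 1)) := by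
      field_simp; norm_num
    have h4 : Real.log 4 * (k + 1) ≤ 1.3863 * (k + 1) := by gcongr
    have h5 := mul_le_mul_of_nonneg_left hpi (show 0 ≤ 3 * t by linarith)
    rw [mul_add, h3] at h5
    linarith
  have htot := totient_ge k
  rw [← hs] at htot
  have hcmp : 2.25 * (k : ℝ) < 3 * t * (k * (92160 / 510510 * (18 / (18 + (s : ℝ))))) := by
    have hs0 : (0 : ℝ) ≤ s := s.cast_nonneg
    have : 2.25 < 3 * t * (92160 / 510510 * (18 / (18 + (s : ℝ)))) := by
      have hpos : 0 < 18 + (s : ℝ) := by positivity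
      rw [show 3 * t * (92160 / 510510 * (18 / (18 + (s : ℝ)))) =
        3 * t * (92160 / 510510) * 18 / (18 + s) by ring, lt_div_iff₀ hpos]
      linarith
    calc _ < 3 * t * (92160 / 510510 * (18 / (18 + (s : ℝ)))) * k := by gcongr
      _ = _ := by ring
  have hlt : 3 * t * (primePi ((k : ℝ) + 1) + 100) < 3 * t * (k.totient : ℝ) :=
    (hmain.trans_lt hcmp).trans_le (mul_le_mul_of_nonneg_left htot (by linarith))
  exact_mod_cast lt_of_mul_lt_mul_left hlt (by linarith)
end

section
/- For every integer k ≥ 5.5·10^5, the prime with index π(k+1) + 100 satisfies p_{π(k+1)+100} < 1.5·k. -/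
open scoped BigOperators

open Finset in
/-- Legendre's identity for `log m!`, with the range of summation extended up to any `N ≥ m`. -/
theorem log_factorial_eq_sum_vonMangoldt {m N : ℕ} (h : m ≤ N) :
    Real.log (m.factorial) =
      ∑ d ∈ Ioc 0 N, ArithmeticFunction.vonMangoldt d * ((m / d : ℕ) : ℝ) := by
  have h1 : Real.log (m.factorial) = ∑ n ∈ Ioc 0 m, Real.log n := by
    clear h
    induction m with
    | zero => simp
    | succ m ih =>
      rw [Finset.sum_Ioc_succ_top (Nat.zero_le m), ← ih, Nat.factorial_succ, Nat.cast_mul,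
        Real.log_mul (by positivity) (by positivity)]
      ring
  have h2 := ArithmeticFunction.sum_Ioc_mul_zeta_eq_sum ArithmeticFunction.vonMangoldt m
  rw [ArithmeticFunction.vonMangoldt_mul_zeta] at h2
  simp only [ArithmeticFunction.log_apply] at h2
  rw [h1, h2]
  refine Finset.sum_subset (Finset.Ioc_subset_Ioc_right h) fun d hd hd' => ?_
  simp only [Finset.mem_Ioc] at hd hd'
  rw [Nat.div_eq_of_lt (by omega)]
  simp

theorem mul_log_sub_log_le {a b : ℝ} (ha : 0 < a) (hb : 0 < b) :
    a * (Real.log b - Real.log a) ≤ b - a := by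
  have h := Real.log_le_sub_one_of_pos (div_pos hb ha)
  rw [Real.log_div hb.ne' ha.ne'] at h
  calc a * (Real.log b - Real.log a) ≤ a * (b / a - 1) := by gcongr
    _ = b - a := by field_simp

theorem log_factorial_bounds {n : ℕ} (hn : 1 ≤ n) :
    n * Real.log n - n + 1 ≤ Real.log (n.factorial) ∧
      Real.log (n.factorial) ≤ n * Real.log n - n + 1 + Real.log n := by
  induction n, hn using Nat.le_induction with
  | base => simp
  | succ n hn ih =>
    have hn0 : (0 : ℝ) < n := by exact_mod_cast hn
    have h1 := mul_log_sub_log_le hn0 (by positivity : (0 : ℝ) < n + 1)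
    have h2 := mul_log_sub_log_le (by positivity : (0 : ℝ) < n + 1) hn0
    rw [Nat.factorial_succ, Nat.cast_mul, Real.log_mul (by positivity) (by positivity)]
    push_cast
    constructor <;> nlinarith [ih.1, ih.2]

theorem log_floor_factorial_bounds {x : ℝ} (hx : 1 ≤ x) :
    x * Real.log x - x - Real.log x + 1 ≤ Real.log (⌊x⌋₊.factorial) ∧
      Real.log (⌊x⌋₊.factorial) ≤ x * Real.log x - x + 1 + Real.log x := by
  have hx0 : 0 < x := by linarith
  have hn : 1 ≤ ⌊x⌋₊ := (Nat.one_le_floor_iff x).2 hx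
  have hn0 : (1 : ℝ) ≤ ⌊x⌋₊ := by exact_mod_cast hn
  have hle : (⌊x⌋₊ : ℝ) ≤ x := Nat.floor_le hx0.le
  have hlt : x < ⌊x⌋₊ + 1 := Nat.lt_floor_add_one x
  obtain ⟨h1, h2⟩ := log_factorial_bounds hn
  generalize Real.log (⌊x⌋₊.factorial) = F at *
  generalize (⌊x⌋₊ : ℝ) = m at *
  have hm0 : 0 < m := by linarith
  have h3 := mul_log_sub_log_le hm0 hx0
  have h4 := mul_log_sub_log_le hx0 hm0
  have h5 : Real.log m ≤ Real.log x := Real.log_le_log hm0 hle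
  have h6 : 0 ≤ Real.log m := Real.log_nonneg hn0
  constructor
  · nlinarith [mul_nonneg (sub_nonneg.2 hlt.le) (h6.trans h5)]
  · nlinarith [mul_nonneg (sub_nonneg.2 hle) h6]

/-- Chebyshev's combination of logarithms of factorials. -/
noncomputable def chebyshevLogQuotient (n : ℕ) : ℝ :=
  Real.log (n.factorial) - Real.log ((n / 2).factorial) - Real.log ((n / 3).factorial)
    - Real.log ((n / 5).factorial) + Real.log ((n / 30).factorial)

/-- Chebyshev's constant `0.92129…`. -/
noncomputable def chebyshevConst : ℝ :=
  Real.log 2 / 2 + Real.log 3 / 3 + Real.log 5 / 5 - Real.log 30 / 30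

theorem chebyshevConst_gt : (0.91 : ℝ) < chebyshevConst := by
  have h2 := Real.log_two_gt_d9
  have h30 : Real.log 30 = Real.log 2 + Real.log 3 + Real.log 5 := by
    rw [← Real.log_mul (by norm_num) (by norm_num), ← Real.log_mul (by norm_num) (by norm_num)]
    norm_num
  have h3 : 19 * Real.log 2 ≤ 12 * Real.log 3 := by
    have := Real.log_le_log (by norm_num) (by norm_num : (2 : ℝ) ^ 19 ≤ 3 ^ 12)
    simpa [Real.log_pow] using this
  have h5 : 9 * Real.log 2 ≤ 4 * Real.log 5 := by
    have := Real.log_le_log (by norm_num) (by norm_num : (2 : ℝ) ^ 9 ≤ 5 ^ 4)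
    simpa [Real.log_pow] using this
  unfold chebyshevConst
  linarith

theorem chebyshevLogQuotient_bounds {n : ℕ} (hn : 30 ≤ n) :
    chebyshevConst * n - 5 * Real.log n - 1 ≤ chebyshevLogQuotient n ∧
      chebyshevLogQuotient n ≤ chebyshevConst * n + 5 * Real.log n := by
  have hn' : (30 : ℝ) ≤ n := by exact_mod_cast hn
  have hn0 : (n : ℝ) ≠ 0 := by positivity
  obtain ⟨a1, b1⟩ := log_factorial_bounds (show 1 ≤ n by omega)
  obtain ⟨a2, b2⟩ := log_floor_factorial_bounds (show 1 ≤ (n : ℝ) / 2 by linarith)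
  obtain ⟨a3, b3⟩ := log_floor_factorial_bounds (show 1 ≤ (n : ℝ) / 3 by linarith)
  obtain ⟨a5, b5⟩ := log_floor_factorial_bounds (show 1 ≤ (n : ℝ) / 5 by linarith)
  obtain ⟨a30, b30⟩ := log_floor_factorial_bounds (show 1 ≤ (n : ℝ) / 30 by linarith)
  rw [Nat.floor_div_ofNat, Nat.floor_natCast, Real.log_div hn0 (by norm_num)] at *
  have := Real.log_pos (show (1 : ℝ) < 2 by norm_num)
  have := Real.log_pos (show (1 : ℝ) < 3 by norm_num)
  have := Real.log_pos (show (1 : ℝ) < 5 by norm_num)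
  have := Real.log_pos (show (1 : ℝ) < 30 by norm_num)
  unfold chebyshevLogQuotient chebyshevConst
  constructor <;> linarith

open Finset in
theorem chebyshevLogQuotient_eq_sum (n : ℕ) :
    chebyshevLogQuotient n = ∑ d ∈ Ioc 0 n, ArithmeticFunction.vonMangoldt d *
      (((n / d : ℕ) : ℝ) - ((n / 2 / d : ℕ) : ℝ) - ((n / 3 / d : ℕ) : ℝ)
        - ((n / 5 / d : ℕ) : ℝ) + ((n / 30 / d : ℕ) : ℝ)) := by
  unfold chebyshevLogQuotient
  rw [log_factorial_eq_sum_vonMangoldt le_rfl,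
    log_factorial_eq_sum_vonMangoldt (Nat.div_le_self n 2),
    log_factorial_eq_sum_vonMangoldt (Nat.div_le_self n 3),
    log_factorial_eq_sum_vonMangoldt (Nat.div_le_self n 5),
    log_factorial_eq_sum_vonMangoldt (Nat.div_le_self n 30)]
  simp only [← Finset.sum_sub_distrib, ← Finset.sum_add_distrib]
  exact Finset.sum_congr rfl fun d _ => by ring

theorem chebyshevLogQuotient_le_psi (n : ℕ) : chebyshevLogQuotient n ≤ Chebyshev.psi n := by
  rw [chebyshevLogQuotient_eq_sum, Chebyshev.psi, Nat.floor_natCast]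
  refine Finset.sum_le_sum fun d _ => ?_
  refine mul_le_of_le_one_right ArithmeticFunction.vonMangoldt_nonneg ?_
  simp only [Nat.div_right_comm n _ d]
  have : n / d + n / d / 30 ≤ 1 + n / d / 2 + n / d / 3 + n / d / 5 := by omega
  have : ((n / d : ℕ) : ℝ) + (n / d / 30 : ℕ) ≤
    1 + (n / d / 2 : ℕ) + (n / d / 3 : ℕ) + (n / d / 5 : ℕ) := by exact_mod_cast this
  linarith

open Finset in
theorem psi_le_psi_div_six_add (n : ℕ) :
    Chebyshev.psi n ≤ Chebyshev.psi ((n / 6 : ℕ) : ℝ) + chebyshevLogQuotient n := by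
  rw [chebyshevLogQuotient_eq_sum, Chebyshev.psi, Chebyshev.psi, Nat.floor_natCast,
    Nat.floor_natCast]
  have hsub : ∑ d ∈ Ioc 0 (n / 6), ArithmeticFunction.vonMangoldt d =
      ∑ d ∈ Ioc 0 n, if d ≤ n / 6 then ArithmeticFunction.vonMangoldt d else 0 := by
    rw [← Finset.sum_filter]
    refine Finset.sum_congr ?_ fun _ _ => rfl
    ext d
    simp only [Finset.mem_filter, Finset.mem_Ioc]
    omega
  rw [hsub, ← Finset.sum_add_distrib]
  refine Finset.sum_le_sum fun d hd => ?_
  have hd0 : 0 < d := (Finset.mem_Ioc.1 hd).1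
  have hdn : d ≤ n := (Finset.mem_Ioc.1 hd).2
  simp only [Nat.div_right_comm n _ d]
  have hΛ : 0 ≤ ArithmeticFunction.vonMangoldt d := ArithmeticFunction.vonMangoldt_nonneg
  split_ifs with h
  · refine le_add_of_nonneg_right (mul_nonneg hΛ ?_)
    have : n / d / 2 + n / d / 3 + n / d / 5 ≤ n / d + n / d / 30 := by omega
    have : ((n / d / 2 : ℕ) : ℝ) + (n / d / 3 : ℕ) + (n / d / 5 : ℕ) ≤
      (n / d : ℕ) + (n / d / 30 : ℕ) := by exact_mod_cast this
    linarith
  · rw [zero_add]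
    refine le_mul_of_one_le_right hΛ ?_
    have h1 : 1 ≤ n / d := (Nat.one_le_div_iff hd0).2 hdn
    have h6 : n / d < 6 := by
      rw [Nat.div_lt_iff_lt_mul hd0]
      omega
    have : 1 + n / d / 2 + n / d / 3 + n / d / 5 ≤ n / d + n / d / 30 := by omega
    have : 1 + ((n / d / 2 : ℕ) : ℝ) + (n / d / 3 : ℕ) + (n / d / 5 : ℕ) ≤
      (n / d : ℕ) + (n / d / 30 : ℕ) := by exact_mod_cast this
    linarith

theorem psi_le_chebyshevConst_mul {n : ℕ} (hn : 180 ≤ n) :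
    Chebyshev.psi n ≤ (7 / 6 * chebyshevConst + 0.15) * n + 10 * Real.log n := by
  have hn' : (180 : ℝ) ≤ n := by exact_mod_cast hn
  have h1 := psi_le_psi_div_six_add n
  have h2 := psi_le_psi_div_six_add (n / 6)
  have b1 := (chebyshevLogQuotient_bounds (show 30 ≤ n by omega)).2
  have b2 := (chebyshevLogQuotient_bounds (show 30 ≤ n / 6 by omega)).2
  have hc := Chebyshev.psi_le_const_mul_self (Nat.cast_nonneg (α := ℝ) (n / 6 / 6))
  have hd1 : ((n / 6 : ℕ) : ℝ) ≤ n / 6 := Nat.cast_div_le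
  have hd2 : ((n / 6 / 6 : ℕ) : ℝ) ≤ (n / 6 : ℕ) / 6 := Nat.cast_div_le
  have hlog : Real.log ((n / 6 : ℕ) : ℝ) ≤ Real.log n :=
    Real.log_le_log (by exact_mod_cast (show 0 < n / 6 by omega))
      (by exact_mod_cast Nat.div_le_self n 6)
  have h4 : Real.log 4 + 4 ≤ 5.4 := by
    rw [show (4 : ℝ) = 2 ^ 2 by norm_num, Real.log_pow]
    have := Real.log_two_lt_d9
    norm_num
    linarith
  have hc' : (Real.log 4 + 4) * ((n / 6 / 6 : ℕ) : ℝ) ≤ 5.4 * (n / 36) := by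
    gcongr
    linarith
  have hA : chebyshevConst * ((n / 6 : ℕ) : ℝ) ≤ chebyshevConst * (n / 6) := by
    have := chebyshevConst_gt
    gcongr
  linarith

theorem le_theta_of_chebyshevConst {n : ℕ} (hn : 30 ≤ n) :
    chebyshevConst * n - 5 * Real.log n - 1 - 2 * √n * Real.log n ≤ Chebyshev.theta n := by
  have h1 := (chebyshevLogQuotient_bounds hn).1
  have h2 := chebyshevLogQuotient_le_psi n
  have h3 := Chebyshev.psi_sub_theta_le (x := n) (by exact_mod_cast (show 1 ≤ n by omega))
  linarith

theorem theta_sub_theta_le {a b : ℕ} (hab : a ≤ b) :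
    Chebyshev.theta b - Chebyshev.theta a ≤
      ((Nat.count Nat.Prime (b + 1) : ℝ) - Nat.count Nat.Prime (a + 1)) * Real.log b := by
  induction b, hab using Nat.le_induction with
  | base => simp
  | succ b hab ih =>
    have hθ : Chebyshev.theta ((b + 1 : ℕ) : ℝ) =
        Chebyshev.theta b + if (b + 1).Prime then Real.log (b + 1 : ℕ) else 0 := by
      simp only [Chebyshev.theta, Nat.floor_natCast, Finset.sum_filter]
      rw [Finset.sum_Ioc_succ_top (Nat.zero_le b)]
    have hlog : Real.log b ≤ Real.log (b + 1 : ℕ) := by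
      rcases Nat.eq_zero_or_pos b with rfl | hb
      · simp
      · exact Real.log_le_log (by exact_mod_cast hb) (by push_cast; linarith)
    have hcount : (Nat.count Nat.Prime (a + 1) : ℝ) ≤ Nat.count Nat.Prime (b + 1) := by
      exact_mod_cast Nat.count_monotone _ (by omega)
    have h := mul_le_mul_of_nonneg_left hlog (sub_nonneg.2 hcount)
    rw [hθ, Nat.count_succ Nat.Prime (b + 1)]
    split_ifs with hp <;> push_cast at * <;> linarith

theorem log_error_lt {y : ℝ} (hy : 810000 ≤ y) :
    (2 * √y + 120) * Real.log y < 0.1 * y - 10 := by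
  obtain ⟨t, ht, rfl⟩ : ∃ t : ℝ, 30 ≤ t ∧ y = t ^ 4 := by
    refine ⟨√√y, ?_, ?_⟩
    · rw [Real.le_sqrt' (by norm_num), Real.le_sqrt' (by norm_num)]
      norm_num
      linarith
    · rw [show (4 : ℕ) = 2 * 2 by norm_num, pow_mul, Real.sq_sqrt (Real.sqrt_nonneg _),
        Real.sq_sqrt (by linarith)]
  have hsq : √(t ^ 4) = t ^ 2 := by
    rw [show t ^ 4 = (t ^ 2) ^ 2 by ring, Real.sqrt_sq (by positivity)]
  have hlog : Real.log t ≤ t / 32 + 2.5 := by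
    have h1 := Real.log_le_sub_one_of_pos (show 0 < t / 32 by linarith)
    rw [Real.log_div (by linarith) (by norm_num), show (32 : ℝ) = 2 ^ 5 by norm_num,
      Real.log_pow] at h1
    have := Real.log_two_lt_d9
    norm_num at *
    linarith
  rw [hsq, Real.log_pow]
  push_cast
  calc (2 * t ^ 2 + 120) * (4 * Real.log t) ≤ (2 * t ^ 2 + 120) * (4 * (t / 32 + 2.5)) := by gcongr
    _ < 0.1 * t ^ 4 - 10 := by
      obtain ⟨s, rfl⟩ : ∃ s, t = 30 + s := ⟨t - 30, by ring⟩
      have hs : 0 ≤ s := by linarith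
      have : 0 ≤ s ^ 2 := by positivity
      have : 0 ≤ s ^ 3 := by positivity
      have : 0 ≤ s ^ 4 := by positivity
      ring_nf
      linarith

theorem nthPrime_primePi_add_100_lt (k : ℕ) (hk : 550000 ≤ k) :
    (nthPrime (primePi ((k : ℝ) + 1) + 100) : ℝ) < 1.5 * k := by
  obtain ⟨m, hm⟩ : ∃ m, m = (3 * k - 1) / 2 := ⟨_, rfl⟩
  have hπ : primePi ((k : ℝ) + 1) = Nat.count Nat.Prime (k + 1 + 1) := by
    rw [primePi, Nat.count_eq_card_filter_range, show (k : ℝ) + 1 = ((k + 1 : ℕ) : ℝ) by simp,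
      Nat.floor_natCast]
  have hkR : (550000 : ℝ) ≤ k := by exact_mod_cast hk
  have hm1 : 1.5 * (k : ℝ) - 1 ≤ m := by
    have : 3 * k ≤ 2 * m + 2 := by omega
    have : 3 * (k : ℝ) ≤ 2 * m + 2 := by exact_mod_cast this
    linarith
  have hm2 : (m : ℝ) < 1.5 * k := by
    have : 2 * m < 3 * k := by omega
    have : 2 * (m : ℝ) < 3 * k := by exact_mod_cast this
    linarith
  suffices hmain : Nat.count Nat.Prime (k + 1 + 1) + 99 < Nat.count Nat.Prime (m + 1) by
    have h := Nat.nth_lt_of_lt_count hmain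
    have h' : nthPrime (primePi ((k : ℝ) + 1) + 100) ≤ m := by
      rw [nthPrime, hπ]
      exact Nat.lt_succ_iff.1 h
    exact lt_of_le_of_lt (by exact_mod_cast h') hm2
  by_contra! hcon
  have hcon' : (Nat.count Nat.Prime (m + 1) : ℝ) ≤ Nat.count Nat.Prime (k + 1 + 1) + 99 := by
    exact_mod_cast hcon
  have hlog0 : 0 ≤ Real.log m := Real.log_natCast_nonneg m
  have hdiff : Chebyshev.theta m - Chebyshev.theta (k + 1 : ℕ) ≤ 99 * Real.log m :=
    (theta_sub_theta_le (show k + 1 ≤ m by omega)).trans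
      (mul_le_mul_of_nonneg_right (by linarith) hlog0)
  have hlow := le_theta_of_chebyshevConst (show 30 ≤ m by omega)
  have hup := (Chebyshev.theta_le_psi _).trans
    (psi_le_chebyshevConst_mul (show 180 ≤ k + 1 by omega))
  have hlogk : Real.log (k + 1 : ℕ) ≤ Real.log m :=
    Real.log_le_log (by positivity) (by exact_mod_cast (show k + 1 ≤ m by omega))
  have herr := log_error_lt (y := m) (by linarith)
  have hA := chebyshevConst_gt
  have hk2 : ((k + 1 : ℕ) : ℝ) ≤ 2 / 3 * m + 2 := by push_cast; linarith
  have hup2 : (7 / 6 * chebyshevConst + 0.15) * ((k + 1 : ℕ) : ℝ) ≤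
      (7 / 6 * chebyshevConst + 0.15) * (2 / 3 * m + 2) := by gcongr
  have hprod : 0 ≤ (chebyshevConst - 0.91) * ((m : ℝ) * (2 / 9) - 7 / 3) :=
    mul_nonneg (by linarith) (by linarith)
  linarith
end

section
/- Let k > 1 be an integer. If there exists a prime p with k < p < p_{φ(k)} such that the residue of p modulo k is also a prime, then k is not a P-integer. -/
open scoped BigOperators

/-- The `i`-th (0-indexed) prime not dividing `k`, in increasing order. -/
noncomputable def nthPrimeNotDvd (k i : ℕ) : ℕ := Nat.nth (fun p => p.Prime ∧ ¬ p ∣ k) i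

/-- `k` is a `P`-integer: `k > 1` and the first `φ(k)` primes not dividing `k` are pairwise
incongruent modulo `k` and their residues are exactly the residues coprime to `k`. -/
def IsPInteger (k : ℕ) : Prop :=
  1 < k ∧
  Set.InjOn (fun i => nthPrimeNotDvd k i % k) (Set.Iio k.totient) ∧
  (fun i => nthPrimeNotDvd k i % k) '' Set.Iio k.totient = {r | r < k ∧ Nat.Coprime r k}

/-- A prime `p` not dividing `k` is the `i`-th such prime for some `i` not exceeding the number of
primes below `p`. -/
theorem exists_nthPrimeNotDvd_eq {k p : ℕ} (hp : p.Prime) (hpk : ¬ p ∣ k) :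
    ∃ i ≤ Nat.primeCounting' p, nthPrimeNotDvd k i = p := by
  classical
  exact ⟨Nat.count (fun p => p.Prime ∧ ¬ p ∣ k) p, Nat.count_mono_left fun _ _ h => h.1,
    Nat.nth_count (p := fun p => p.Prime ∧ ¬ p ∣ k) ⟨hp, hpk⟩⟩

theorem not_PInteger_of_prime_residue (k : ℕ) (hk : 1 < k) (p : ℕ) (hp : p.Prime)
    (h1 : k < p) (h2 : p < nthPrime k.totient) (h3 : (p % k).Prime) :
    ¬ IsPInteger k := by
  rintro ⟨-, hinj, -⟩
  have hpk : ¬ p ∣ k := fun h => h1.not_ge (Nat.le_of_dvd (by lia) h)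
  have hlt : p % k < k := Nat.mod_lt _ (by lia)
  have hqk : ¬ p % k ∣ k := fun h => by
    have hqp : p % k ∣ p := (Nat.dvd_mod_iff h).1 dvd_rfl
    have := (Nat.prime_dvd_prime_iff_eq h3 hp).1 hqp
    lia
  have hcount : Nat.primeCounting' p < k.totient - 1 := by
    have h : Nat.nth Nat.Prime (Nat.primeCounting' p) < Nat.nth Nat.Prime (k.totient - 1) :=
      (Nat.nth_count hp).trans_lt h2
    exact (Nat.nth_lt_nth Nat.infinite_setOfPred_prime).1 h
  have hmono : Nat.primeCounting' (p % k) ≤ Nat.primeCounting' p :=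
    Nat.monotone_primeCounting' (Nat.mod_le p k)
  obtain ⟨i, hi, hip⟩ := exists_nthPrimeNotDvd_eq hp hpk
  obtain ⟨j, hj, hjq⟩ := exists_nthPrimeNotDvd_eq h3 hqk
  have hij : i = j := hinj (Set.mem_Iio.2 (by lia)) (Set.mem_Iio.2 (by lia))
    (by simp only [hip, hjq, Nat.mod_mod])
  subst hij
  lia
end

section
/- Let k > 1 be an odd integer. If there exists a prime p with 2k < p < min(3k, p_{φ(2k)}) such that the residue of p modulo 2k is also a prime, then k is not a P-integer. -/
open scoped BigOperators

/-- Fewer than `φ(k)` primes not dividing `k` lie below a number smaller than the `φ(k)`-th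
prime. -/
theorem count_prime_not_dvd_lt_totient {k q : ℕ} (hk : 0 < k)
    (hq : q < nthPrime k.totient) :
    Nat.count (fun p => p.Prime ∧ ¬ p ∣ k) q < k.totient := by
  have hpos : 0 < k.totient := Nat.totient_pos.mpr hk
  have hle : Nat.count (fun p => p.Prime ∧ ¬ p ∣ k) q ≤ Nat.count Nat.Prime q :=
    Nat.count_mono_left fun _ _ h => h.1
  have hcount : Nat.count Nat.Prime q ≤ k.totient - 1 :=
    (Nat.count_monotone Nat.Prime hq.le).trans_eq
      (Nat.count_nth_of_infinite Nat.infinite_setOfPred_prime _)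
  omega

theorem not_PInteger_of_prime_residue_odd (k : ℕ) (hk : 1 < k) (hodd : Odd k)
    (p : ℕ) (hp : p.Prime) (h1 : 2 * k < p)
    (h2 : p < min (3 * k) (nthPrime (2 * k).totient)) (h3 : (p % (2 * k)).Prime) :
    ¬ IsPInteger k := by
  rintro ⟨-, hinj, -⟩
  have htot : (2 * k).totient = k.totient := by
    rw [Nat.totient_mul (Nat.coprime_two_left.mpr hodd), Nat.totient_two, one_mul]
  obtain ⟨h3k, hnth⟩ := lt_min_iff.mp h2
  rw [htot] at hnth
  have hr : p % (2 * k) = p - 2 * k := by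
    rw [Nat.mod_eq_sub_mod h1.le, Nat.mod_eq_of_lt (by omega)]
  rw [hr] at h3
  obtain ⟨r, rfl⟩ := Nat.exists_eq_add_of_lt h1
  obtain ⟨q, hq⟩ : ∃ q, q = r + 1 := ⟨_, rfl⟩
  have hpq : 2 * k + r + 1 = 2 * k + q := by omega
  rw [hpq] at hp hnth h3k h3
  rw [Nat.add_sub_cancel_left] at h3
  have hqk : ¬ q ∣ k := fun h => by
    have := (Nat.prime_dvd_prime_iff_eq h3 hp).mp ((h.mul_left 2).add dvd_rfl)
    omega
  have hpk : ¬ 2 * k + q ∣ k := fun h => by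
    have := Nat.le_of_dvd (by omega) h
    omega
  have hq_nth : nthPrimeNotDvd k (Nat.count (fun p => p.Prime ∧ ¬ p ∣ k) q) = q :=
    Nat.nth_count (p := fun p => p.Prime ∧ ¬ p ∣ k) ⟨h3, hqk⟩
  have hp_nth : nthPrimeNotDvd k (Nat.count (fun p => p.Prime ∧ ¬ p ∣ k) (2 * k + q)) =
      2 * k + q :=
    Nat.nth_count (p := fun p => p.Prime ∧ ¬ p ∣ k) ⟨hp, hpk⟩
  have heq := hinj (count_prime_not_dvd_lt_totient (q := q) (by omega) (by omega))
    (count_prime_not_dvd_lt_totient (by omega) hnth)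
    (by simp only [hq_nth, hp_nth, Nat.mul_add_mod_self_right])
  rw [heq, hp_nth] at hq_nth
  omega
end

section
/- An integer k with 1 < k ≤ 30 is a P-integer if and only if k ∈ {2, 4, 6, 12, 18, 30}. -/
open scoped BigOperators

/-- If exactly `φ(k)` primes below `M` do not divide `k`, then `k` is a `P`-integer precisely when
those primes form a reduced residue system. -/
theorem isPInteger_iff_of_count {k M : ℕ} (hk : 1 < k)
    (hM : Nat.count (fun p => p.Prime ∧ ¬ p ∣ k) M = k.totient) :
    IsPInteger k ↔
      (∀ x ∈ (Finset.range M).filter (fun p => p.Prime ∧ ¬ p ∣ k),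
        ∀ y ∈ (Finset.range M).filter (fun p => p.Prime ∧ ¬ p ∣ k), x % k = y % k → x = y) ∧
      ((Finset.range M).filter (fun p => p.Prime ∧ ¬ p ∣ k)).image (· % k) =
        (Finset.range k).filter (Nat.Coprime · k) := by
  set P : ℕ → Prop := fun p => p.Prime ∧ ¬ p ∣ k with hP
  have hlt {i : ℕ} (hi : i < k.totient) : Nat.nth P i < M := Nat.nth_lt_of_lt_count (hM ▸ hi)
  have hcard {i : ℕ} (hi : i < k.totient) (hf : (Set.ofPred P).Finite) : i < hf.toFinset.card := by
    refine lt_of_lt_of_le hi ?_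
    rw [← hM, Nat.count_eq_card_filter_range]
    exact Finset.card_le_card fun x hx => hf.mem_toFinset.2 (Finset.mem_filter.1 hx).2
  have himg : Nat.nth P '' Set.Iio k.totient = ↑((Finset.range M).filter P) := by
    ext x
    simp only [Set.mem_image, Set.mem_Iio, Finset.coe_filter, Finset.mem_range, Set.mem_ofPred_eq]
    constructor
    · rintro ⟨i, hi, rfl⟩
      exact ⟨hlt hi, Nat.nth_mem i (hcard hi)⟩
    · rintro ⟨hx, hPx⟩
      exact ⟨Nat.count P x, hM ▸ Nat.count_strict_mono hPx hx, Nat.nth_count hPx⟩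
  have hinj : Set.InjOn (Nat.nth P) (Set.Iio k.totient) := by
    by_cases hf : (Set.ofPred P).Finite
    · exact (Nat.nth_injOn hf).mono fun i hi => hcard hi hf
    · exact (Nat.nth_injective hf).injOn
  have hcomp : (fun i => nthPrimeNotDvd k i % k) = (· % k) ∘ Nat.nth P := rfl
  rw [IsPInteger, hcomp, Set.image_comp, himg, and_iff_right hk, hinj.comp_iff, himg]
  refine and_congr Iff.rfl ?_
  rw [← Finset.coe_inj]
  simp [hP]

theorem exists_count_eq_totient_of_le_30 {k : ℕ} (h1 : 1 < k) (h2 : k ≤ 30) : ∃ M,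
    Nat.count (fun p => p.Prime ∧ ¬ p ∣ k) M = k.totient ∧
    (((∀ x ∈ (Finset.range M).filter (fun p => p.Prime ∧ ¬ p ∣ k),
        ∀ y ∈ (Finset.range M).filter (fun p => p.Prime ∧ ¬ p ∣ k), x % k = y % k → x = y) ∧
      ((Finset.range M).filter (fun p => p.Prime ∧ ¬ p ∣ k)).image (· % k) =
        (Finset.range k).filter (Nat.Coprime · k)) ↔ k ∈ ({2, 4, 6, 12, 18, 30} : Finset ℕ)) := by
  have key : ∀ k ∈ Finset.Icc 2 30, ∃ M ∈ ([4, 6, 6, 12, 8, 18, 12, 18, 14, 32, 14, 42, 20, 30, 24,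
      60, 20, 68, 30, 44, 38, 84, 30, 74, 44, 68, 44, 110, 32] : List ℕ)[k - 2]?,
      Nat.count (fun p => p.Prime ∧ ¬ p ∣ k) M = k.totient ∧
      (((∀ x ∈ (Finset.range M).filter (fun p => p.Prime ∧ ¬ p ∣ k),
          ∀ y ∈ (Finset.range M).filter (fun p => p.Prime ∧ ¬ p ∣ k), x % k = y % k → x = y) ∧
        ((Finset.range M).filter (fun p => p.Prime ∧ ¬ p ∣ k)).image (· % k) =
          (Finset.range k).filter (Nat.Coprime · k)) ↔ k ∈ ({2, 4, 6, 12, 18, 30} : Finset ℕ)) := by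
    decide +kernel
  obtain ⟨M, -, hM⟩ := key k (Finset.mem_Icc.2 ⟨h1, h2⟩)
  exact ⟨M, hM⟩

theorem PInteger_iff_of_le_30 (k : ℕ) (h1 : 1 < k) (h2 : k ≤ 30) :
    IsPInteger k ↔ k ∈ ({2, 4, 6, 12, 18, 30} : Set ℕ) := by
  obtain ⟨M, hM, h⟩ := exists_count_eq_totient_of_le_30 h1 h2
  rw [isPInteger_iff_of_count h1 hM, h]
  simp
end
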